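/- arXiv:2203.00666 — 5 statements merged into one kernel-verified Lean document; each statement's English description precedes it below -/
import Mathlib

section
/- Fix θ ∈ (0, 1/2), Δ > 0 and δ ∈ (0, 2]. There exist constants ρ₀ > 0 and C > 0 (depending only on θ, Δ, δ) such that for all ρ ∈ (0, ρ₀): ∫₀^ρ ∫_ℝ p_r(y)² · min{|y|^{2θ}, exp(Δ|y|^{2−δ})} dy dr ≤ C · ρ^{1/2 + θ}. -/
open MeasureTheory Real

/-- The standard heat kernel `p_t(x) = (2πt)^{-1/2} exp(-x²/(2t))`. -/
noncomputable def heatKernel (t x : ℝ) : ℝ :=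
  (2 * Real.pi * t) ^ (-(1:ℝ)/2) * Real.exp (-x ^ 2 / (2 * t))

/-- The absolute Gaussian moments: `∫ |y|^s exp (-y² / r) dy = Γ((s + 1) / 2) r^((s + 1) / 2)`. -/
lemma integral_abs_rpow_mul_exp_neg_sq_div {s r : ℝ} (hs : 0 ≤ s) (hr : 0 < r) :
    ∫ y : ℝ, |y| ^ s * Real.exp (-y ^ 2 / r) = Real.Gamma ((s + 1) / 2) * r ^ ((s + 1) / 2) := by
  have h := integral_comp_abs (f := fun y : ℝ => y ^ s * Real.exp (-y ^ 2 / r))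
  simp only [sq_abs] at h
  have h2 := integral_rpow_mul_exp_neg_mul_rpow (p := 2) (q := s) (b := r⁻¹) two_pos
    (by linarith) (inv_pos.2 hr)
  have h3 : ∫ y in Set.Ioi (0 : ℝ), y ^ s * Real.exp (-y ^ 2 / r) =
      ∫ y in Set.Ioi (0 : ℝ), y ^ s * Real.exp (-r⁻¹ * y ^ (2 : ℝ)) := by
    congr 1 with y
    rw [Real.rpow_two, neg_div, div_eq_inv_mul, neg_mul]
  rw [h, h3, h2, Real.inv_rpow hr.le, neg_div, Real.rpow_neg hr.le, inv_inv]
  ring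

lemma integrable_abs_rpow_mul_exp_neg_sq_div {s r : ℝ} (hs : 0 ≤ s) (hr : 0 < r) :
    Integrable fun y : ℝ => |y| ^ s * Real.exp (-y ^ 2 / r) := by
  refine .of_integral_ne_zero ?_
  rw [integral_abs_rpow_mul_exp_neg_sq_div hs hr]
  have := Real.Gamma_pos_of_pos (s := (s + 1) / 2) (by linarith)
  positivity

lemma heatKernel_sq {r : ℝ} (hr : 0 < r) (y : ℝ) :
    heatKernel r y ^ 2 = (2 * Real.pi * r)⁻¹ * Real.exp (-y ^ 2 / r) := by
  have h : 0 ≤ 2 * Real.pi * r := by positivity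
  rw [heatKernel, mul_pow, ← Real.rpow_natCast, ← Real.rpow_mul h, ← Real.exp_nat_mul,
    ← Real.rpow_neg_one]
  congr 2
  · norm_num
  · push_cast
    field_simp

lemma integral_heatKernel_sq_mul_min_le {θ r : ℝ} (hθ : 0 < θ) (hr : 0 < r) {w : ℝ → ℝ}
    (hw : ∀ y, 0 ≤ w y) :
    ∫ y : ℝ, heatKernel r y ^ 2 * min (|y| ^ (2 * θ)) (w y) ≤
      (2 * Real.pi)⁻¹ * Real.Gamma (θ + 1 / 2) * r ^ (θ - 1 / 2) := by
  have hs : 0 ≤ 2 * θ := by positivity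
  calc
    _ ≤ ∫ y : ℝ, (2 * Real.pi * r)⁻¹ * (|y| ^ (2 * θ) * Real.exp (-y ^ 2 / r)) := by
      refine integral_mono_of_nonneg (.of_forall fun y => ?_)
        ((integrable_abs_rpow_mul_exp_neg_sq_div hs hr).const_mul _) (.of_forall fun y => ?_)
      · exact mul_nonneg (sq_nonneg _) (le_min (by positivity) (hw y))
      · dsimp only
        rw [heatKernel_sq hr, mul_assoc, mul_comm (|y| ^ (2 * θ))]
        gcongr
        exact min_le_left _ _
    _ = _ := by
      rw [integral_const_mul, integral_abs_rpow_mul_exp_neg_sq_div hs hr,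
        show (2 * θ + 1) / 2 = θ - 1 / 2 + 1 by ring, Real.rpow_add_one hr.ne',
        show θ - 1 / 2 + 1 = θ + 1 / 2 by ring]
      field_simp

theorem heat_kernel_min_weight_estimate
    (θ Δ δ : ℝ) (hθ : θ ∈ Set.Ioo (0:ℝ) (1/2)) (hΔ : 0 < Δ)
    (hδ : δ ∈ Set.Ioc (0:ℝ) 2) :
    ∃ ρ₀ > (0:ℝ), ∃ C > (0:ℝ), ∀ ρ ∈ Set.Ioo (0:ℝ) ρ₀,
      (∫ r in Set.Ioo (0:ℝ) ρ, ∫ y : ℝ,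
        (heatKernel r y) ^ 2 * min (|y| ^ (2 * θ)) (Real.exp (Δ * |y| ^ (2 - δ))))
        ≤ C * ρ ^ (1/2 + θ) := by
  have hθ0 : 0 < θ := hθ.1
  have hΓ : 0 < Real.Gamma (θ + 1 / 2) := Real.Gamma_pos_of_pos (by positivity)
  refine ⟨1, one_pos, (2 * Real.pi)⁻¹ * Real.Gamma (θ + 1 / 2) / (1 / 2 + θ), by positivity,
    fun ρ hρ => ?_⟩
  have hexp : -1 < θ - 1 / 2 := by linarith
  calc
    _ ≤ ∫ r in Set.Ioo (0:ℝ) ρ,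
        (2 * Real.pi)⁻¹ * Real.Gamma (θ + 1 / 2) * r ^ (θ - 1 / 2) := by
      refine integral_mono_of_nonneg (.of_forall fun r => integral_nonneg fun y => ?_)
        (((intervalIntegral.integrableOn_Ioo_rpow_iff hρ.1).2 hexp).const_mul _)
        ((ae_restrict_mem measurableSet_Ioo).mono fun r hr => ?_)
      · exact mul_nonneg (sq_nonneg _) (le_min (by positivity) (Real.exp_nonneg _))
      · exact integral_heatKernel_sq_mul_min_le hθ0 hr.1 fun y => Real.exp_nonneg _
    _ = _ := by
      rw [integral_const_mul, ← integral_Ioc_eq_integral_Ioo,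
        ← intervalIntegral.integral_of_le hρ.1.le, integral_rpow (.inl hexp),
        show θ - 1 / 2 + 1 = 1 / 2 + θ by ring, Real.zero_rpow (by positivity)]
      ring
end

section
/- Fix T > 1, a ∈ (1/2, 1), Δ > 0 and δ ∈ (0, 2]. There exist constants ε₀ > 0 and C > 0 such that for all ε ∈ (0, ε₀) and all t ∈ [T^{-1}, T]: ∫₀^{t − ε^a} ∫_ℝ (p_{t+ε−s}(x) − p_{t−s}(x))² · exp(Δ|x|^{2−δ}) dx ds ≤ C · ε^{2 − 3a/2}. -/
open MeasureTheory Real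

lemma hasDerivAt_heatKernel {u : ℝ} (hu : 0 < u) (x : ℝ) :
    HasDerivAt (fun v => heatKernel v x)
      (u⁻¹ * (x ^ 2 / (2 * u) - 1 / 2) * heatKernel u x) u := by
  have hpos : 0 < 2 * Real.pi * u := by positivity
  have h1 : HasDerivAt (fun v : ℝ => 2 * Real.pi * v) (2 * Real.pi) u := by
    simpa using (hasDerivAt_id u).const_mul (2 * Real.pi)
  have h2 := h1.rpow_const (p := -(1:ℝ)/2) (Or.inl hpos.ne')
  have h3 : HasDerivAt (fun v : ℝ => 2 * v) 2 u := by
    simpa using (hasDerivAt_id u).const_mul (2 : ℝ)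
  have h4 := (((hasDerivAt_const u (-x ^ 2)).div h3 (by positivity)).exp)
  have h5 := h2.mul h4
  refine h5.congr_deriv ?_
  rw [Real.rpow_sub_one hpos.ne']
  unfold heatKernel
  simp only [Pi.div_apply]
  field_simp
  ring

lemma heatKernel_sub_sq_le {r ε : ℝ} (hr : 0 < r) (hε : 0 ≤ ε) (hεr : ε ≤ r) (x : ℝ) :
    (heatKernel (r + ε) x - heatKernel r x) ^ 2
      ≤ 4 * ε ^ 2 * r ^ (-3 : ℝ) * Real.exp (-x ^ 2 / (4 * r)) := by
  have hbound : ∀ u ∈ Set.Icc r (r + ε),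
      ‖u⁻¹ * (x ^ 2 / (2 * u) - 1 / 2) * heatKernel u x‖
        ≤ 2 * r⁻¹ * r ^ (-(1:ℝ)/2) * Real.exp (-x ^ 2 / (8 * r)) := by
    rintro u ⟨hru, hur⟩
    have hu : 0 < u := hr.trans_le hru
    have hy : 0 ≤ x ^ 2 / (2 * u) := by positivity
    have hpoly : |x ^ 2 / (2 * u) - 1 / 2| ≤ 2 * Real.exp (x ^ 2 / (2 * u) / 2) := by
      have := Real.add_one_le_exp (x ^ 2 / (2 * u) / 2)
      rw [abs_le]
      constructor <;> linarith
    have hpow : (2 * Real.pi * u) ^ (-(1:ℝ)/2) ≤ r ^ (-(1:ℝ)/2) := by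
      refine Real.rpow_le_rpow_of_nonpos hr ?_ (by norm_num)
      nlinarith [Real.pi_gt_three]
    have hexp : Real.exp (x ^ 2 / (2 * u) / 2) * Real.exp (-x ^ 2 / (2 * u))
        ≤ Real.exp (-x ^ 2 / (8 * r)) := by
      rw [← Real.exp_add, Real.exp_le_exp]
      have : x ^ 2 / (8 * r) ≤ x ^ 2 / (4 * u) := by
        apply div_le_div_of_nonneg_left (sq_nonneg x) (by positivity)
        linarith
      calc x ^ 2 / (2 * u) / 2 + -x ^ 2 / (2 * u) = -(x ^ 2 / (4 * u)) := by
            field_simp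
            ring
        _ ≤ -(x ^ 2 / (8 * r)) := by linarith
        _ = -x ^ 2 / (8 * r) := by ring
    have hinv : u⁻¹ ≤ r⁻¹ := inv_anti₀ hr hru
    unfold heatKernel
    rw [Real.norm_eq_abs, abs_mul, abs_mul, abs_of_pos (inv_pos.2 hu),
      abs_of_nonneg (by positivity : 0 ≤ (2 * Real.pi * u) ^ (-(1:ℝ)/2)
        * Real.exp (-x ^ 2 / (2 * u)))]
    calc u⁻¹ * |x ^ 2 / (2 * u) - 1 / 2|
          * ((2 * Real.pi * u) ^ (-(1:ℝ)/2) * Real.exp (-x ^ 2 / (2 * u)))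
        ≤ r⁻¹ * (2 * Real.exp (x ^ 2 / (2 * u) / 2))
          * (r ^ (-(1:ℝ)/2) * Real.exp (-x ^ 2 / (2 * u))) := by gcongr
      _ = 2 * r⁻¹ * r ^ (-(1:ℝ)/2)
          * (Real.exp (x ^ 2 / (2 * u) / 2) * Real.exp (-x ^ 2 / (2 * u))) := by ring
      _ ≤ _ := by gcongr
  have hmvt := (convex_Icc r (r + ε)).norm_image_sub_le_of_norm_hasDerivWithin_le
    (fun u hu => (hasDerivAt_heatKernel (hr.trans_le hu.1) x).hasDerivWithinAt) hbound
    (Set.left_mem_Icc.2 (by linarith)) (Set.right_mem_Icc.2 (by linarith))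
  rw [add_sub_cancel_left, Real.norm_eq_abs, Real.norm_eq_abs, abs_of_nonneg hε] at hmvt
  have hsq := pow_le_pow_left₀ (abs_nonneg _) hmvt 2
  rw [sq_abs] at hsq
  refine hsq.trans_eq ?_
  have h1 : (r⁻¹) ^ 2 * (r ^ (-(1:ℝ)/2)) ^ 2 = r ^ (-3 : ℝ) := by
    rw [← Real.rpow_neg_one, ← Real.rpow_natCast, ← Real.rpow_natCast, ← Real.rpow_mul hr.le,
      ← Real.rpow_mul hr.le, ← Real.rpow_add hr]
    norm_num
  have h2 : Real.exp (-x ^ 2 / (8 * r)) ^ 2 = Real.exp (-x ^ 2 / (4 * r)) := by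
    rw [← Real.exp_nat_mul]
    congr 1
    push_cast
    field_simp
    ring
  rw [← h1, ← h2]
  ring

lemma exists_mul_abs_rpow_le_add_mul_sq {Δ δ c : ℝ} (hΔ : 0 < Δ) (hδ : δ ∈ Set.Ioc (0:ℝ) 2)
    (hc : 0 < c) : ∃ K, ∀ x : ℝ, Δ * |x| ^ (2 - δ) ≤ K + c * x ^ 2 := by
  obtain ⟨hδ0, hδ2⟩ := hδ
  set M : ℝ := (Δ / c) ^ δ⁻¹ with hM
  have hMpos : 0 < M := by positivity
  refine ⟨Δ * M ^ (2 - δ), fun x => ?_⟩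
  rcases le_total |x| M with h | h
  · have := Real.rpow_le_rpow (abs_nonneg x) h (by linarith : 0 ≤ 2 - δ)
    have := mul_le_mul_of_nonneg_left this hΔ.le
    nlinarith [mul_nonneg hc.le (sq_nonneg x)]
  · have hx : 0 < |x| := hMpos.trans_le h
    have hMδ : M ^ δ = Δ / c := by
      rw [hM, ← Real.rpow_mul (by positivity), inv_mul_cancel₀ hδ0.ne', Real.rpow_one]
    have hxδ : Δ / c ≤ |x| ^ δ := hMδ ▸ Real.rpow_le_rpow hMpos.le h hδ0.le
    have hK : 0 ≤ Δ * M ^ (2 - δ) := by positivity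
    have : Δ * |x| ^ (2 - δ) ≤ c * x ^ 2 := by
      rw [Real.rpow_sub hx, Real.rpow_two, sq_abs, mul_div_assoc', div_le_iff₀ (by positivity)]
      have := (div_le_iff₀ hc).1 hxδ
      nlinarith [mul_le_mul_of_nonneg_left this (sq_nonneg x)]
    linarith

lemma integral_heatKernel_sub_sq_mul_exp_le {T Δ δ K r ε : ℝ}
    (hK : ∀ x : ℝ, Δ * |x| ^ (2 - δ) ≤ K + 1 / (8 * T) * x ^ 2)
    (hr : 0 < r) (hrT : r ≤ T) (hε : 0 ≤ ε) (hεr : ε ≤ r) :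
    ∫ x : ℝ, (heatKernel (r + ε) x - heatKernel r x) ^ 2 * Real.exp (Δ * |x| ^ (2 - δ))
      ≤ 4 * Real.exp K * √(8 * Real.pi) * ε ^ 2 * r ^ (-5 / 2 : ℝ) := by
  have hpt : ∀ x : ℝ,
      (heatKernel (r + ε) x - heatKernel r x) ^ 2 * Real.exp (Δ * |x| ^ (2 - δ))
        ≤ 4 * ε ^ 2 * r ^ (-3 : ℝ) * Real.exp K * Real.exp (-(1 / (8 * r)) * x ^ 2) := by
    intro x
    have hexp : Real.exp (-x ^ 2 / (4 * r)) * Real.exp (Δ * |x| ^ (2 - δ))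
        ≤ Real.exp K * Real.exp (-(1 / (8 * r)) * x ^ 2) := by
      rw [← Real.exp_add, ← Real.exp_add, Real.exp_le_exp]
      have h1 : 1 / (8 * T) ≤ 1 / (8 * r) := by gcongr
      have h2 := mul_le_mul_of_nonneg_right h1 (sq_nonneg x)
      have h3 : -x ^ 2 / (4 * r) = -(2 * (1 / (8 * r) * x ^ 2)) := by
        field_simp
        ring
      linarith [hK x]
    calc _ ≤ 4 * ε ^ 2 * r ^ (-3 : ℝ) * Real.exp (-x ^ 2 / (4 * r))
          * Real.exp (Δ * |x| ^ (2 - δ)) := by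
          gcongr
          exact heatKernel_sub_sq_le hr hε hεr x
      _ = 4 * ε ^ 2 * r ^ (-3 : ℝ)
          * (Real.exp (-x ^ 2 / (4 * r)) * Real.exp (Δ * |x| ^ (2 - δ))) := by ring
      _ ≤ 4 * ε ^ 2 * r ^ (-3 : ℝ) * (Real.exp K * Real.exp (-(1 / (8 * r)) * x ^ 2)) := by
          gcongr
      _ = _ := by ring
  refine (integral_mono_of_nonneg (Filter.Eventually.of_forall fun x => by positivity)
    ((integrable_exp_neg_mul_sq (by positivity : 0 < 1 / (8 * r))).const_mul _)
    (Filter.Eventually.of_forall hpt)).trans_eq ?_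
  rw [integral_const_mul, integral_gaussian]
  have h1 : Real.pi / (1 / (8 * r)) = 8 * Real.pi * r := by
    field_simp
  have h2 : r ^ (-3 : ℝ) * √r = r ^ (-5 / 2 : ℝ) := by
    rw [Real.sqrt_eq_rpow, ← Real.rpow_add hr]
    norm_num
  rw [h1, Real.sqrt_mul (by positivity), ← h2]
  ring

lemma integrableOn_and_setIntegral_sub_rpow_le {t b : ℝ} (hb : 0 < b) (hbt : b ≤ t) :
    IntegrableOn (fun s => (t - s) ^ (-5 / 2 : ℝ)) (Set.Ioo 0 (t - b)) ∧
      ∫ s in Set.Ioo 0 (t - b), (t - s) ^ (-5 / 2 : ℝ) ≤ b ^ (-3 / 2 : ℝ) := by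
  have ht : 0 < t := hb.trans_le hbt
  constructor
  · refine IntegrableOn.mono_set ?_ Set.Ioo_subset_Icc_self
    refine ContinuousOn.integrableOn_Icc ?_
    refine ContinuousOn.rpow_const (by fun_prop) fun s hs => Or.inl ?_
    linarith [hs.2]
  · rw [← integral_Ioc_eq_integral_Ioo, ← intervalIntegral.integral_of_le (by linarith),
      intervalIntegral.integral_comp_sub_left (fun u => u ^ (-5 / 2 : ℝ)),
      sub_sub_cancel, sub_zero, integral_rpow]
    · have h1 : 0 ≤ t ^ (-3 / 2 : ℝ) := by positivity
      have h2 : 0 ≤ b ^ (-3 / 2 : ℝ) := by positivity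
      norm_num at h1 h2 ⊢
      linarith
    · refine Or.inr ⟨by norm_num, ?_⟩
      rw [Set.uIcc_of_le hbt]
      exact fun h => absurd h.1 (not_le.2 hb)

theorem heat_kernel_temporal_difference_estimate
    (T a Δ δ : ℝ) (hT : 1 < T) (ha : a ∈ Set.Ioo (1/2 : ℝ) 1) (hΔ : 0 < Δ)
    (hδ : δ ∈ Set.Ioc (0:ℝ) 2) :
    ∃ ε₀ > (0:ℝ), ∃ C > (0:ℝ), ∀ ε ∈ Set.Ioo (0:ℝ) ε₀, ∀ t ∈ Set.Icc T⁻¹ T,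
      (∫ s in Set.Ioo (0:ℝ) (t - ε ^ a), ∫ x : ℝ,
        (heatKernel (t + ε - s) x - heatKernel (t - s) x) ^ 2
          * Real.exp (Δ * |x| ^ (2 - δ)))
        ≤ C * ε ^ (2 - 3 * a / 2) := by
  obtain ⟨K, hK⟩ := exists_mul_abs_rpow_le_add_mul_sq hΔ hδ (by positivity : 0 < 1 / (8 * T))
  refine ⟨1, one_pos, 4 * Real.exp K * √(8 * Real.pi), by positivity, ?_⟩
  rintro ε ⟨hε0, hε1⟩ t ⟨-, htT⟩
  have hεa : 0 < ε ^ a := by positivity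
  have hle : ε ≤ ε ^ a := by
    simpa using Real.rpow_le_rpow_of_exponent_ge hε0 hε1.le ha.2.le
  rcases lt_or_ge t (ε ^ a) with h | h
  · rw [Set.Ioo_eq_empty (by linarith), setIntegral_empty]
    positivity
  obtain ⟨hint, hval⟩ := integrableOn_and_setIntegral_sub_rpow_le hεa h
  calc _ ≤ ∫ s in Set.Ioo (0:ℝ) (t - ε ^ a),
        4 * Real.exp K * √(8 * Real.pi) * ε ^ 2 * (t - s) ^ (-5 / 2 : ℝ) := by
        refine integral_mono_of_nonneg
          (Filter.Eventually.of_forall fun s => integral_nonneg fun x => by positivity)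
          (hint.const_mul _) ?_
        filter_upwards [ae_restrict_mem measurableSet_Ioo] with s hs
        have h1 : ε ^ a < t - s := by linarith [hs.2]
        rw [show t + ε - s = t - s + ε by ring]
        exact integral_heatKernel_sub_sq_mul_exp_le hK (hεa.trans h1) (by linarith [hs.1]) hε0.le
          (hle.trans h1.le)
    _ ≤ 4 * Real.exp K * √(8 * Real.pi) * ε ^ 2 * (ε ^ a) ^ (-3 / 2 : ℝ) := by
        rw [integral_const_mul]
        gcongr
    _ = _ := by
        rw [mul_assoc, ← Real.rpow_mul hε0.le, ← Real.rpow_two, ← Real.rpow_add hε0]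
        congr 2
        ring
end

section
/- Fix T > 1, Δ > 0 and δ ∈ (0, 2]. There exist constants ε₀ > 0 and C > 0 such that for all ε ∈ (0, ε₀) and all t ∈ [T^{-1}, T]: ∫₀^{t} ∫_ℝ (p_{t+ε−s}(x) − p_{t−s}(x))² · exp(Δ|x|^{2−δ}) dx ds ≤ C · ε^{1/2}. -/
open MeasureTheory Real

/-- A subquadratic power is dominated by any positive multiple of the square, up to a constant. -/
lemma exists_mul_abs_rpow_le_mul_sq_add {Δ δ η : ℝ} (hΔ : 0 < Δ) (hδ : δ ∈ Set.Ioc (0 : ℝ) 2)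
    (hη : 0 < η) : ∃ K : ℝ, ∀ x : ℝ, Δ * |x| ^ (2 - δ) ≤ η * x ^ 2 + K := by
  set R : ℝ := (Δ / η) ^ (1 / δ) with hR
  have hRpos : 0 < R := by positivity
  have hRδ : R ^ δ = Δ / η := by
    rw [hR, ← rpow_mul (by positivity), one_div_mul_cancel hδ.1.ne', rpow_one]
  refine ⟨Δ * R ^ (2 - δ), fun x => ?_⟩
  rcases le_total |x| R with h | h
  · have h1 : |x| ^ (2 - δ) ≤ R ^ (2 - δ) :=
      rpow_le_rpow (abs_nonneg x) h (by linarith [hδ.2])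
    have h2 := mul_le_mul_of_nonneg_left h1 hΔ.le
    have h3 : 0 ≤ η * x ^ 2 := by positivity
    linarith
  · have hx : 0 < |x| := hRpos.trans_le h
    have h1 : Δ / η ≤ |x| ^ δ := hRδ ▸ rpow_le_rpow hRpos.le h hδ.1.le
    have h2 : |x| ^ (2 - δ) = x ^ 2 / |x| ^ δ := by
      rw [rpow_sub hx, rpow_two, sq_abs]
    have h3 : 0 < |x| ^ δ := by positivity
    have h4 : Δ * |x| ^ (2 - δ) ≤ η * x ^ 2 := by
      rw [h2, mul_div_assoc', div_le_iff₀ h3]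
      rw [div_le_iff₀ hη] at h1
      nlinarith [mul_le_mul_of_nonneg_left h1 (sq_nonneg x)]
    have h5 : 0 ≤ Δ * R ^ (2 - δ) := by positivity
    linarith

lemma heatKernel_eq_inv_sqrt_mul (t x : ℝ) (ht : 0 < t) :
    heatKernel t x = (√(2 * π * t))⁻¹ * exp (-(x ^ 2 / (2 * t))) := by
  rw [heatKernel, neg_div, neg_div, rpow_neg (by positivity), ← sqrt_eq_rpow]

lemma inv_sqrt_sub_inv_sqrt_le {a ε : ℝ} (ha : 0 < a) (hε : 0 < ε) :
    (√(2 * π * a))⁻¹ - (√(2 * π * (a + ε)))⁻¹ ≤ min 1 (ε / a) * (√(2 * π * a))⁻¹ := by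
  have hA : 0 < √(2 * π * a) := by positivity
  have hB : 0 < √(2 * π * (a + ε)) := by positivity
  have hAB : √(2 * π * a) ≤ √(2 * π * (a + ε)) := by gcongr; linarith
  have hA2 : √(2 * π * a) ^ 2 = 2 * π * a := sq_sqrt (by positivity)
  have hB2 : √(2 * π * (a + ε)) ^ 2 = 2 * π * (a + ε) := sq_sqrt (by positivity)
  set A := √(2 * π * a)
  set B := √(2 * π * (a + ε))
  rcases min_cases 1 (ε / a) with ⟨h, -⟩ | ⟨h, -⟩ <;> rw [h]
  · have : 0 < B⁻¹ := by positivity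
    linarith
  · have h1 : B ≤ B ^ 2 / A := by
      rw [le_div_iff₀ hA]; nlinarith
    have h2 : B ^ 2 / A = A * (1 + ε / a) := by
      rw [div_eq_iff hA.ne', mul_right_comm, ← sq, hA2, hB2]
      field_simp
    have h3 : A / B ≥ 1 - ε / a := by
      rw [ge_iff_le, le_div_iff₀ hB]
      have h4 : 0 < ε / a := by positivity
      rw [h2] at h1
      rcases le_total (1 - ε / a) 0 with h5 | h5
      · nlinarith
      · nlinarith [mul_le_mul_of_nonneg_left h1 h5, mul_pos hA (mul_pos h4 h4)]
    have h6 : A⁻¹ - B⁻¹ = (1 - A / B) * A⁻¹ := by field_simp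
    rw [h6]
    gcongr
    linarith

lemma exp_neg_sub_exp_neg_le {a ε : ℝ} (ha : 0 < a) (hε : 0 < ε) (x : ℝ) :
    exp (-(x ^ 2 / (2 * (a + ε)))) - exp (-(x ^ 2 / (2 * a)))
      ≤ min 1 (ε / a) * exp (-(x ^ 2 / (4 * (a + ε)))) := by
  set y := x ^ 2 / (4 * (a + ε)) with hy
  have hb : 0 < a + ε := by positivity
  have hy0 : 0 ≤ y := by positivity
  have e1 : x ^ 2 / (2 * (a + ε)) = 2 * y := by rw [hy]; field_simp; ring
  have e2 : x ^ 2 / (2 * a) = 2 * y + 2 * y * (ε / a) := by rw [hy]; field_simp; ring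
  have hr : 0 < ε / a := by positivity
  rw [e1, e2]
  set r := ε / a
  have h0 : exp (-(2 * y + 2 * y * r)) = exp (-(2 * y)) * exp (-(2 * y * r)) := by
    rw [← exp_add]; ring_nf
  have h1 : exp (-(2 * y)) = exp (-y) * exp (-y) := by rw [← exp_add]; ring_nf
  have h2 : exp (-y) ≤ 1 := exp_le_one_iff.2 (by linarith)
  have hpos := exp_pos (-y)
  rcases min_cases 1 r with ⟨h, -⟩ | ⟨h, -⟩ <;> rw [h]
  · nlinarith [exp_pos (-(2 * y + 2 * y * r))]
  · have h3 : 1 - 2 * y * r ≤ exp (-(2 * y * r)) := by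
      linarith [add_one_le_exp (-(2 * y * r))]
    have h4 : exp (-y) * (2 * y) ≤ 1 := by
      have h5 : 2 * y ≤ exp y := two_mul_le_exp
      calc exp (-y) * (2 * y) ≤ exp (-y) * exp y := by gcongr
        _ = 1 := by rw [← exp_add]; simp
    rw [h0, h1]
    calc exp (-y) * exp (-y) - exp (-y) * exp (-y) * exp (-(2 * y * r))
        = exp (-y) * exp (-y) * (1 - exp (-(2 * y * r))) := by ring
      _ ≤ exp (-y) * exp (-y) * (2 * y * r) := by gcongr; linarith
      _ = exp (-y) * (2 * y) * (r * exp (-y)) := by ring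
      _ ≤ 1 * (r * exp (-y)) := by gcongr
      _ = r * exp (-y) := one_mul _

lemma heatKernel_sub_sq_le_s3 {a ε : ℝ} (ha : 0 < a) (hε : 0 < ε) (x : ℝ) :
    (heatKernel (a + ε) x - heatKernel a x) ^ 2 ≤ 2 * min 1 (ε / a) ^ 2 *
      ((a + ε)⁻¹ * exp (-(x ^ 2 / (2 * (a + ε)))) + a⁻¹ * exp (-(x ^ 2 / (2 * a)))) := by
  have hb : 0 < a + ε := by positivity
  rw [heatKernel_eq_inv_sqrt_mul _ _ ha, heatKernel_eq_inv_sqrt_mul _ _ hb]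
  have hα := inv_sqrt_sub_inv_sqrt_le ha hε
  have hE := exp_neg_sub_exp_neg_le ha hε x
  have hαβ : (√(2 * π * (a + ε)))⁻¹ ≤ (√(2 * π * a))⁻¹ := by gcongr; linarith
  have hα2 : (√(2 * π * a))⁻¹ ^ 2 ≤ a⁻¹ := by
    rw [inv_pow, sq_sqrt (by positivity)]
    gcongr
    nlinarith [pi_gt_three]
  have hβ2 : (√(2 * π * (a + ε)))⁻¹ ^ 2 ≤ (a + ε)⁻¹ := by
    rw [inv_pow, sq_sqrt (by positivity)]
    gcongr
    nlinarith [pi_gt_three]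
  have hβ0 : 0 ≤ (√(2 * π * (a + ε)))⁻¹ := by positivity
  have hmono : exp (-(x ^ 2 / (2 * a))) ≤ exp (-(x ^ 2 / (2 * (a + ε)))) := by
    gcongr; linarith
  have hF2 : exp (-(x ^ 2 / (4 * (a + ε)))) ^ 2 = exp (-(x ^ 2 / (2 * (a + ε)))) := by
    rw [← exp_nat_mul]; congr 1; push_cast; field_simp; ring
  have hG2 : exp (-(x ^ 2 / (2 * a))) ^ 2 ≤ exp (-(x ^ 2 / (2 * a))) := by
    have : exp (-(x ^ 2 / (2 * a))) ≤ 1 := exp_le_one_iff.2 (neg_nonpos.2 (by positivity))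
    nlinarith [exp_pos (-(x ^ 2 / (2 * a)))]
  have hm : 0 ≤ min 1 (ε / a) := by positivity
  rw [← hF2] at hmono ⊢
  rw [← hF2] at hE
  set F := exp (-(x ^ 2 / (4 * (a + ε))))
  set G := exp (-(x ^ 2 / (2 * a)))
  set α := (√(2 * π * a))⁻¹
  set β := (√(2 * π * (a + ε)))⁻¹
  set m := min 1 (ε / a)
  have hG0 : 0 ≤ G := (exp_pos _).le
  have h1 : (β * (F ^ 2 - G)) ^ 2 ≤ m ^ 2 * ((a + ε)⁻¹ * F ^ 2) := by
    calc (β * (F ^ 2 - G)) ^ 2 = β ^ 2 * (F ^ 2 - G) ^ 2 := by ring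
      _ ≤ (a + ε)⁻¹ * (m * F) ^ 2 := by
        gcongr
      _ = m ^ 2 * ((a + ε)⁻¹ * F ^ 2) := by ring
  have h2 : ((α - β) * G) ^ 2 ≤ m ^ 2 * (a⁻¹ * G) := by
    calc ((α - β) * G) ^ 2 = (α - β) ^ 2 * G ^ 2 := by ring
      _ ≤ (m * α) ^ 2 * G := by
        gcongr
      _ = m ^ 2 * (α ^ 2 * G) := by ring
      _ ≤ m ^ 2 * (a⁻¹ * G) := by gcongr
  have h3 : (β * F ^ 2 - α * G) ^ 2 ≤ 2 * (β * (F ^ 2 - G)) ^ 2 + 2 * ((α - β) * G) ^ 2 := by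
    nlinarith [sq_nonneg (β * (F ^ 2 - G) + (α - β) * G)]
  linarith

lemma integrable_exp_neg_sq_div {a : ℝ} (ha : 0 < a) :
    Integrable fun x : ℝ => exp (-(x ^ 2 / (4 * a))) := by
  convert integrable_exp_neg_mul_sq (show 0 < (4 * a)⁻¹ by positivity) using 3
  ring

lemma inv_mul_integral_exp_neg_sq_div {a : ℝ} (ha : 0 < a) :
    a⁻¹ * ∫ x : ℝ, exp (-(x ^ 2 / (4 * a))) = √(4 * π) * a ^ (-(1 / 2) : ℝ) := by
  have h : ∫ x : ℝ, exp (-(x ^ 2 / (4 * a))) = √(4 * π) * √a := by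
    rw [← sqrt_mul (by positivity)]
    convert integral_gaussian (4 * a)⁻¹ using 3
    · ring_nf
    · field_simp
  rw [h, rpow_neg ha.le, ← sqrt_eq_rpow]
  have hs : √a ≠ 0 := by positivity
  nth_rewrite 1 [← sq_sqrt ha.le]
  field_simp

/-- Weighted `L²` bound at a fixed time for the difference of two heat kernels. -/
lemma integral_heatKernel_sub_sq_mul_exp_le_s3 {a ε M K : ℝ} {w : ℝ → ℝ} (ha : 0 < a) (hε : 0 < ε)
    (hM : a + ε ≤ M) (hw : ∀ x, w x ≤ (4 * M)⁻¹ * x ^ 2 + K) :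
    ∫ x : ℝ, (heatKernel (a + ε) x - heatKernel a x) ^ 2 * exp (w x)
      ≤ 4 * √(4 * π) * exp K * (min 1 (ε / a) ^ 2 * a ^ (-(1 / 2) : ℝ)) := by
  have hb : 0 < a + ε := by positivity
  have hexp : ∀ c, 0 < c → c ≤ M → ∀ x,
      exp (-(x ^ 2 / (2 * c))) * exp (w x) ≤ exp K * exp (-(x ^ 2 / (4 * c))) := by
    intro c hc hcM x
    rw [← exp_add, ← exp_add, exp_le_exp]
    have h1 : (4 * M)⁻¹ ≤ (4 * c)⁻¹ := by gcongr
    have h2 := mul_le_mul_of_nonneg_right h1 (sq_nonneg x)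
    have h3 : x ^ 2 / (2 * c) = 2 * ((4 * c)⁻¹ * x ^ 2) := by field_simp; ring
    have h4 : x ^ 2 / (4 * c) = (4 * c)⁻¹ * x ^ 2 := by field_simp
    rw [h3, h4]
    linarith [hw x]
  have ib := (integrable_exp_neg_sq_div hb).const_mul (a + ε)⁻¹
  have ia := (integrable_exp_neg_sq_div ha).const_mul a⁻¹
  calc ∫ x : ℝ, (heatKernel (a + ε) x - heatKernel a x) ^ 2 * exp (w x)
      ≤ ∫ x : ℝ, 2 * min 1 (ε / a) ^ 2 * exp K * ((a + ε)⁻¹ * exp (-(x ^ 2 / (4 * (a + ε))))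
          + a⁻¹ * exp (-(x ^ 2 / (4 * a)))) := by
        refine integral_mono_of_nonneg (.of_forall fun x => by positivity)
          ((ib.add ia).const_mul _) (.of_forall fun x => ?_)
        have hB := mul_le_mul_of_nonneg_left (hexp (a + ε) hb hM x) (inv_nonneg.2 hb.le)
        have hA := mul_le_mul_of_nonneg_left (hexp a ha (by linarith) x) (inv_nonneg.2 ha.le)
        have hm : 0 ≤ 2 * min 1 (ε / a) ^ 2 := by positivity
        have hD := mul_le_mul_of_nonneg_right (heatKernel_sub_sq_le_s3 ha hε x) (exp_pos (w x)).le
        refine hD.trans ?_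
        dsimp only
        have hS := mul_le_mul_of_nonneg_left (add_le_add hB hA) hm
        linarith
    _ = 2 * min 1 (ε / a) ^ 2 * exp K *
          (√(4 * π) * (a + ε) ^ (-(1 / 2) : ℝ) + √(4 * π) * a ^ (-(1 / 2) : ℝ)) := by
        rw [integral_const_mul, integral_add ib ia, integral_const_mul, integral_const_mul,
          inv_mul_integral_exp_neg_sq_div hb, inv_mul_integral_exp_neg_sq_div ha]
    _ ≤ 2 * min 1 (ε / a) ^ 2 * exp K *
          (√(4 * π) * a ^ (-(1 / 2) : ℝ) + √(4 * π) * a ^ (-(1 / 2) : ℝ)) := by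
        have : (a + ε) ^ (-(1 / 2) : ℝ) ≤ a ^ (-(1 / 2) : ℝ) :=
          rpow_le_rpow_of_nonpos ha (by linarith) (by norm_num)
        gcongr
    _ = _ := by ring

/-- An integrable majorant of `u ↦ min 1 (ε / u) ^ 2 * u ^ (-1/2)` with integral of
order `ε ^ (1/2)`. -/
noncomputable def timeMajorant (ε : ℝ) : ℝ → ℝ :=
  (Set.Ioc 0 ε).indicator (fun u => u ^ (-(1 / 2) : ℝ)) +
    (Set.Ioi ε).indicator (fun u => ε ^ 2 * u ^ (-(5 / 2) : ℝ))

lemma timeMajorant_nonneg {ε : ℝ} (hε : 0 < ε) (u : ℝ) : 0 ≤ timeMajorant ε u := by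
  refine add_nonneg (Set.indicator_nonneg (fun v hv => ?_) u)
    (Set.indicator_nonneg (fun v hv => ?_) u)
  · exact rpow_nonneg hv.1.le _
  · exact mul_nonneg (sq_nonneg _) (rpow_nonneg (hε.trans hv).le _)

lemma min_sq_mul_rpow_le_timeMajorant {ε u : ℝ} (hε : 0 < ε) (hu : 0 < u) :
    min 1 (ε / u) ^ 2 * u ^ (-(1 / 2) : ℝ) ≤ timeMajorant ε u := by
  have hm : 0 ≤ min 1 (ε / u) := by positivity
  have hp : 0 < u ^ (-(1 / 2) : ℝ) := by positivity
  rcases le_or_gt u ε with h | h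
  · have : timeMajorant ε u = u ^ (-(1 / 2) : ℝ) := by
      simp [timeMajorant, hu, h]
    rw [this]
    have : min 1 (ε / u) ^ 2 ≤ 1 := pow_le_one₀ hm (min_le_left _ _)
    nlinarith
  · have h1 : timeMajorant ε u = ε ^ 2 * u ^ (-(5 / 2) : ℝ) := by
      simp [timeMajorant, h, h.not_ge]
    have h2 : u ^ (-(5 / 2) : ℝ) = u ^ (-(1 / 2) : ℝ) / u ^ 2 := by
      rw [← rpow_two, ← rpow_sub hu]; norm_num
    rw [h1, h2]
    calc min 1 (ε / u) ^ 2 * u ^ (-(1 / 2) : ℝ) ≤ (ε / u) ^ 2 * u ^ (-(1 / 2) : ℝ) := by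
          gcongr
          exact min_le_right _ _
      _ = _ := by ring

lemma integrableOn_Ioc_rpow_neg_half (ε : ℝ) (hε : 0 < ε) :
    IntegrableOn (fun u : ℝ => u ^ (-(1 / 2) : ℝ)) (Set.Ioc 0 ε) :=
  (intervalIntegrable_iff_integrableOn_Ioc_of_le hε.le).1
    (intervalIntegral.intervalIntegrable_rpow' (by norm_num))

lemma integrableOn_Ioi_sq_mul_rpow (ε : ℝ) (hε : 0 < ε) :
    IntegrableOn (fun u : ℝ => ε ^ 2 * u ^ (-(5 / 2) : ℝ)) (Set.Ioi ε) :=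
  (integrableOn_Ioi_rpow_of_lt (by norm_num) hε).const_mul _

lemma integrable_timeMajorant {ε : ℝ} (hε : 0 < ε) : Integrable (timeMajorant ε) :=
  ((integrableOn_Ioc_rpow_neg_half ε hε).integrable_indicator measurableSet_Ioc).add
    ((integrableOn_Ioi_sq_mul_rpow ε hε).integrable_indicator measurableSet_Ioi)

lemma integral_timeMajorant {ε : ℝ} (hε : 0 < ε) :
    ∫ u, timeMajorant ε u = 8 / 3 * ε ^ ((1 : ℝ) / 2) := by
  have h1 : ∫ u in Set.Ioc 0 ε, u ^ (-(1 / 2) : ℝ) = 2 * ε ^ ((1 : ℝ) / 2) := by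
    rw [← intervalIntegral.integral_of_le hε.le, integral_rpow (.inl (by norm_num))]
    norm_num
    ring
  have h2 : ∫ u in Set.Ioi ε, ε ^ 2 * u ^ (-(5 / 2) : ℝ) = 2 / 3 * ε ^ ((1 : ℝ) / 2) := by
    rw [integral_const_mul, integral_Ioi_rpow_of_lt (by norm_num) hε]
    have : ε ^ ((1 : ℝ) / 2) = ε ^ 2 * ε ^ (-(5 / 2) + 1 : ℝ) := by
      rw [← rpow_two, ← rpow_add hε]; norm_num
    rw [this]
    norm_num
    ring
  unfold timeMajorant
  rw [integral_add'
    ((integrableOn_Ioc_rpow_neg_half ε hε).integrable_indicator measurableSet_Ioc)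
    ((integrableOn_Ioi_sq_mul_rpow ε hε).integrable_indicator measurableSet_Ioi),
    integral_indicator measurableSet_Ioc,
    integral_indicator measurableSet_Ioi, h1, h2]
  ring

theorem heat_kernel_temporal_difference_full_estimate
    (T Δ δ : ℝ) (hT : 1 < T) (hΔ : 0 < Δ) (hδ : δ ∈ Set.Ioc (0:ℝ) 2) :
    ∃ ε₀ > (0:ℝ), ∃ C > (0:ℝ), ∀ ε ∈ Set.Ioo (0:ℝ) ε₀, ∀ t ∈ Set.Icc T⁻¹ T,
      (∫ s in Set.Ioo (0:ℝ) t, ∫ x : ℝ,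
        (heatKernel (t + ε - s) x - heatKernel (t - s) x) ^ 2
          * Real.exp (Δ * |x| ^ (2 - δ)))
        ≤ C * ε ^ ((1:ℝ)/2) := by
  obtain ⟨K, hK⟩ := exists_mul_abs_rpow_le_mul_sq_add hΔ hδ
    (show 0 < (4 * (T + 1))⁻¹ by positivity)
  refine ⟨1, one_pos, 4 * √(4 * π) * exp K * (8 / 3), by positivity, ?_⟩
  rintro ε ⟨hε, hε1⟩ t ⟨-, htT⟩
  have hmaj := ((integrable_timeMajorant hε).comp_sub_left t).const_mul
    (4 * √(4 * π) * exp K)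
  calc _ ≤ ∫ s in Set.Ioo (0:ℝ) t, 4 * √(4 * π) * exp K * timeMajorant ε (t - s) := by
        refine integral_mono_of_nonneg
          (.of_forall fun s => integral_nonneg fun x => by positivity) hmaj.integrableOn ?_
        filter_upwards [ae_restrict_mem measurableSet_Ioo] with s hs
        have hu : 0 < t - s := sub_pos.2 hs.2
        rw [show t + ε - s = t - s + ε by ring]
        refine (integral_heatKernel_sub_sq_mul_exp_le_s3 hu hε (by linarith [hs.1]) hK).trans ?_
        gcongr
        exact min_sq_mul_rpow_le_timeMajorant hε hu
    _ ≤ ∫ s, 4 * √(4 * π) * exp K * timeMajorant ε (t - s) :=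
        setIntegral_le_integral hmaj
          (.of_forall fun s => mul_nonneg (by positivity) (timeMajorant_nonneg hε _))
    _ = _ := by
        rw [integral_const_mul, integral_sub_left_eq_self (timeMajorant ε) volume t,
          integral_timeMajorant hε]
        ring
end

section
/- Let s < t be real numbers and c ≥ 0. Let g, h : [s, t] → ℝ, and suppose h is β-Hölder continuous for some β > 1/4, i.e., there exists K ≥ 0 with |h(x) − h(y)| ≤ K|x − y|^β for all x, y ∈ [s, t]. If lim_{ε↓0} V_{4,ε}(g) = c, then lim_{ε↓0} V_{4,ε}(g + h) = c. -/
open Filter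

/-- The `α`-variation of `g : [s,t] → ℝ` at scale `ε`:
`V_{α,ε}(g) = ∑_{u ∈ [s+ε,t] ∩ εℤ} |g(u) − g(u−ε)|^α`. -/
noncomputable def scaleVariation (α ε s t : ℝ) (g : ℝ → ℝ) : ℝ :=
  ∑ j ∈ Finset.Icc ⌈(s + ε) / ε⌉ ⌊t / ε⌋, |g (j * ε) - g ((j : ℝ) * ε - ε)| ^ α

theorem scaleVariation_nonneg (α ε s t : ℝ) (g : ℝ → ℝ) : 0 ≤ scaleVariation α ε s t g :=
  Finset.sum_nonneg fun _ _ => Real.rpow_nonneg (abs_nonneg _) _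

theorem scaleVariation_neg (α ε s t : ℝ) (g : ℝ → ℝ) :
    scaleVariation α ε s t (-g) = scaleVariation α ε s t g := by
  unfold scaleVariation
  refine Finset.sum_congr rfl fun j _ => ?_
  rw [Pi.neg_apply, Pi.neg_apply, ← abs_neg]
  ring_nf

theorem scaleVariation_add_rpow_le {α : ℝ} (hα : 1 ≤ α) (ε s t : ℝ) (g h : ℝ → ℝ) :
    scaleVariation α ε s t (g + h) ^ (1 / α) ≤
      scaleVariation α ε s t g ^ (1 / α) + scaleVariation α ε s t h ^ (1 / α) := by
  unfold scaleVariation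
  simpa only [Pi.add_apply, add_sub_add_comm] using
    Real.Lp_add_le (Finset.Icc ⌈(s + ε) / ε⌉ ⌊t / ε⌋)
      (fun j : ℤ => g (j * ε) - g ((j : ℝ) * ε - ε))
      (fun j : ℤ => h (j * ε) - h ((j : ℝ) * ε - ε)) hα

theorem scaleVariation_le_of_holder {α ε s t β K : ℝ} (hα : 0 ≤ α) (hε : 0 < ε) (hst : s ≤ t)
    (hK : 0 ≤ K) {h : ℝ → ℝ}
    (hh : ∀ x ∈ Set.Icc s t, ∀ y ∈ Set.Icc s t, |h x - h y| ≤ K * |x - y| ^ β) :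
    scaleVariation α ε s t h ≤ (t - s) * K ^ α * ε ^ (α * β - 1) := by
  have hterm : ∀ j ∈ Finset.Icc ⌈(s + ε) / ε⌉ ⌊t / ε⌋,
      |h (j * ε) - h ((j : ℝ) * ε - ε)| ^ α ≤ (K * ε ^ β) ^ α := by
    intro j hj
    rw [Finset.mem_Icc, Int.ceil_le, Int.le_floor, div_le_iff₀ hε, le_div_iff₀ hε] at hj
    have := hh (j * ε) ⟨by linarith, hj.2⟩ (j * ε - ε) ⟨by linarith, by linarith⟩
    rw [sub_sub_cancel, abs_of_pos hε] at this
    exact Real.rpow_le_rpow (abs_nonneg _) this hα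
  have hcard : ((Finset.Icc ⌈(s + ε) / ε⌉ ⌊t / ε⌋).card : ℝ) ≤ (t - s) / ε := by
    rw [Int.card_Icc, ← Int.cast_natCast, Int.toNat_eq_max]
    push_cast
    refine max_le ?_ (div_nonneg (sub_nonneg.2 hst) hε.le)
    have h1 := Int.floor_le (t / ε)
    have h2 := Int.le_ceil ((s + ε) / ε)
    rw [add_div, div_self hε.ne'] at h2
    rw [sub_div, add_div, div_self hε.ne']
    linarith
  calc scaleVariation α ε s t h
      ≤ (Finset.Icc ⌈(s + ε) / ε⌉ ⌊t / ε⌋).card • (K * ε ^ β) ^ α :=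
        Finset.sum_le_card_nsmul _ _ _ hterm
    _ ≤ (t - s) / ε * (K * ε ^ β) ^ α := by
        rw [nsmul_eq_mul]
        gcongr
    _ = (t - s) * K ^ α * ε ^ (α * β - 1) := by
        rw [Real.mul_rpow hK (by positivity), ← Real.rpow_mul hε.le, Real.rpow_sub hε,
          Real.rpow_one, mul_comm β α]
        ring

theorem tendsto_scaleVariation_of_holder {α s t β K : ℝ} (hα : 0 ≤ α) (hαβ : 1 < α * β)
    (hst : s ≤ t) (hK : 0 ≤ K) {h : ℝ → ℝ}
    (hh : ∀ x ∈ Set.Icc s t, ∀ y ∈ Set.Icc s t, |h x - h y| ≤ K * |x - y| ^ β) :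
    Tendsto (fun ε => scaleVariation α ε s t h) (nhdsWithin 0 (Set.Ioi 0)) (nhds 0) := by
  have hlim : Tendsto (fun ε : ℝ => (t - s) * K ^ α * ε ^ (α * β - 1))
      (nhdsWithin 0 (Set.Ioi 0)) (nhds 0) := by
    have := ((Real.continuousAt_rpow_const 0 (α * β - 1) (Or.inr (by linarith))).tendsto.const_mul
      ((t - s) * K ^ α)).mono_left (nhdsWithin_le_nhds (s := Set.Ioi 0))
    rwa [Real.zero_rpow (by linarith), mul_zero] at this
  refine squeeze_zero' (Eventually.of_forall fun ε => scaleVariation_nonneg _ _ _ _ _) ?_ hlim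
  filter_upwards [self_mem_nhdsWithin] with ε hε
  exact scaleVariation_le_of_holder hα hε hst hK hh

theorem tendsto_scaleVariation_add {α s t c : ℝ} (hα : 1 ≤ α) {l : Filter ℝ} {g h : ℝ → ℝ}
    (hg : Tendsto (fun ε => scaleVariation α ε s t g) l (nhds c))
    (hh : Tendsto (fun ε => scaleVariation α ε s t h) l (nhds 0)) :
    Tendsto (fun ε => scaleVariation α ε s t (g + h)) l (nhds c) := by
  have hα0 : 0 < α := by linarith
  have hinv : 0 < 1 / α := by positivity
  rcases l.eq_or_neBot with rfl | _
  · exact tendsto_bot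
  have hc : 0 ≤ c := ge_of_tendsto' hg fun ε => scaleVariation_nonneg _ _ _ _ _
  have hg' := hg.rpow_const (p := 1 / α) (Or.inr hinv.le)
  have hh' := hh.rpow_const (p := 1 / α) (Or.inr hinv.le)
  rw [Real.zero_rpow hinv.ne'] at hh'
  have hroot : Tendsto (fun ε => scaleVariation α ε s t (g + h) ^ (1 / α)) l
      (nhds (c ^ (1 / α))) := by
    refine tendsto_of_tendsto_of_tendsto_of_le_of_le (by simpa only [sub_zero] using hg'.sub hh')
      (by simpa only [add_zero] using hg'.add hh') (fun ε => ?_)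
      fun ε => scaleVariation_add_rpow_le hα ε s t g h
    have := scaleVariation_add_rpow_le hα ε s t (g + h) (-h)
    rw [add_neg_cancel_right, scaleVariation_neg] at this
    exact sub_le_iff_le_add.2 this
  have := hroot.rpow_const (p := α) (Or.inr hα0.le)
  simpa only [← Real.rpow_mul hc, ← Real.rpow_mul (scaleVariation_nonneg _ _ _ _ _),
    one_div_mul_cancel hα0.ne', Real.rpow_one] using this

theorem quartic_variation_holder_transfer
    (s t c : ℝ) (hst : s < t) (hc : 0 ≤ c) (g h : ℝ → ℝ)
    (β K : ℝ) (hβ : 1/4 < β) (hK : 0 ≤ K)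
    (hHolder : ∀ x ∈ Set.Icc s t, ∀ y ∈ Set.Icc s t, |h x - h y| ≤ K * |x - y| ^ β)
    (hg : Tendsto (fun ε => scaleVariation 4 ε s t g)
      (nhdsWithin 0 (Set.Ioi 0)) (nhds c)) :
    Tendsto (fun ε => scaleVariation 4 ε s t (g + h))
      (nhdsWithin 0 (Set.Ioi 0)) (nhds c) :=
  tendsto_scaleVariation_add (by norm_num) hg
    (tendsto_scaleVariation_of_holder (by norm_num) (by linarith) hst.le hK hHolder)
end

section
/- Fix T > 1, λ > 0 and δ ∈ (0, 2]. There exists a constant C > 0 such that for all t ∈ [T^{-1}, T] and all ε ∈ (0, 1]: ∫_ℝ |p_{t+ε}(y) − p_t(y)| · exp(λ(1 + |y|^{2−δ})) dy ≤ C · ε. -/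
open MeasureTheory Real

theorem heatKernel_hasDerivAt {s : ℝ} (hs : 0 < s) (y : ℝ) :
    HasDerivAt (fun u => heatKernel u y)
      (heatKernel s y * (y ^ 2 / (2 * s ^ 2) - 1 / (2 * s))) s := by
  have hpos : 0 < 2 * Real.pi * s := by positivity
  have h1 : HasDerivAt (fun u : ℝ => 2 * Real.pi * u) (2 * Real.pi) s := by
    simpa using (hasDerivAt_id s).const_mul (2 * Real.pi)
  have h2 := h1.rpow_const (p := -(1:ℝ)/2) (Or.inl hpos.ne')
  have h3 : HasDerivAt (fun u : ℝ => -y ^ 2 / (2 * u)) (y ^ 2 / (2 * s ^ 2)) s := by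
    have h := (hasDerivAt_const s (-y ^ 2)).div ((hasDerivAt_id s).const_mul 2)
      (by simpa using hs.ne')
    refine h.congr_deriv ?_
    simp only [id]
    field_simp
    ring
  refine (h2.mul h3.exp).congr_deriv ?_
  rw [heatKernel, Real.rpow_sub_one hpos.ne']
  field_simp
  ring

/-- On `[a, b]` the time derivative of the heat kernel is dominated by a Gaussian. -/
theorem abs_heatKernel_deriv_le {a b s : ℝ} (ha : 0 < a) (has : a ≤ s) (hsb : s ≤ b) (y : ℝ) :
    |heatKernel s y * (y ^ 2 / (2 * s ^ 2) - 1 / (2 * s))| ≤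
      (2 * Real.pi * a) ^ (-(1:ℝ)/2) * Real.exp (-y ^ 2 / (2 * b)) *
        (y ^ 2 / (2 * a ^ 2) + 1 / (2 * a)) := by
  have hs : 0 < s := ha.trans_le has
  have hb : 0 < b := hs.trans_le hsb
  have hk : 0 ≤ heatKernel s y := by unfold heatKernel; positivity
  rw [abs_mul, abs_of_nonneg hk]
  have hp : (2 * Real.pi * s) ^ (-(1:ℝ)/2) ≤ (2 * Real.pi * a) ^ (-(1:ℝ)/2) :=
    Real.rpow_le_rpow_of_nonpos (by positivity) (by gcongr) (by norm_num)
  have he : Real.exp (-y ^ 2 / (2 * s)) ≤ Real.exp (-y ^ 2 / (2 * b)) := by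
    rw [neg_div, neg_div]
    gcongr
  have hd : |y ^ 2 / (2 * s ^ 2) - 1 / (2 * s)| ≤ y ^ 2 / (2 * a ^ 2) + 1 / (2 * a) := by
    refine (abs_sub _ _).trans ?_
    rw [abs_of_nonneg (by positivity), abs_of_nonneg (by positivity)]
    gcongr
  unfold heatKernel
  gcongr

/-- A subquadratic power is bounded by an arbitrarily small multiple of the square,
up to a constant. -/
theorem exists_mul_one_add_rpow_le {lam δ c : ℝ} (hlam : 0 < lam) (hδ : δ ∈ Set.Ioc (0:ℝ) 2)
    (hc : 0 < c) : ∃ M : ℝ, ∀ y : ℝ, lam * (1 + |y| ^ (2 - δ)) ≤ M + c * y ^ 2 := by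
  set R : ℝ := (c / lam) ^ (-δ⁻¹) with hR
  have hRpos : 0 < R := by positivity
  have hRδ : R ^ (-δ) = c / lam := by
    rw [hR, ← Real.rpow_mul (by positivity), neg_mul_neg, inv_mul_cancel₀ hδ.1.ne', Real.rpow_one]
  refine ⟨lam * (1 + R ^ (2 - δ)), fun y => ?_⟩
  rcases le_total |y| R with h | h
  · have : |y| ^ (2 - δ) ≤ R ^ (2 - δ) :=
      Real.rpow_le_rpow (abs_nonneg y) h (by linarith [hδ.2])
    have : lam * (1 + |y| ^ (2 - δ)) ≤ lam * (1 + R ^ (2 - δ)) := by gcongr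
    have : 0 ≤ c * y ^ 2 := by positivity
    linarith
  · have hy : 0 < |y| := hRpos.trans_le h
    have h1 : |y| ^ (-δ) ≤ c / lam :=
      hRδ ▸ Real.rpow_le_rpow_of_nonpos hRpos h (by linarith [hδ.1])
    have h2 : |y| ^ (2 - δ) = y ^ 2 * |y| ^ (-δ) := by
      rw [sub_eq_add_neg, Real.rpow_add hy, Real.rpow_two, sq_abs]
    have h3 : lam * |y| ^ (2 - δ) ≤ c * y ^ 2 := by
      calc lam * |y| ^ (2 - δ) = lam * (y ^ 2 * |y| ^ (-δ)) := by rw [h2]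
        _ ≤ lam * (y ^ 2 * (c / lam)) := by gcongr
        _ = c * y ^ 2 := by field_simp
    have : 0 ≤ lam * R ^ (2 - δ) := by positivity
    linarith

theorem abs_heatKernel_sub_le {a b t ε : ℝ} (ha : 0 < a) (hat : a ≤ t) (hε : 0 ≤ ε)
    (htb : t + ε ≤ b) (y : ℝ) :
    |heatKernel (t + ε) y - heatKernel t y| ≤
      (2 * Real.pi * a) ^ (-(1:ℝ)/2) * Real.exp (-y ^ 2 / (2 * b)) *
        (y ^ 2 / (2 * a ^ 2) + 1 / (2 * a)) * ε := by
  have h := (convex_Icc t (t + ε)).norm_image_sub_le_of_norm_hasDerivWithin_le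
    (f := fun u => heatKernel u y)
    (fun s hs => (heatKernel_hasDerivAt (ha.trans_le (hat.trans hs.1)) y).hasDerivWithinAt)
    (fun s hs => abs_heatKernel_deriv_le ha (hat.trans hs.1) (hs.2.trans htb) y)
    (Set.left_mem_Icc.2 (by linarith)) (Set.right_mem_Icc.2 (by linarith))
  simpa [abs_of_nonneg hε] using h

theorem heat_kernel_drift_term_estimate
    (T lam δ : ℝ) (hT : 1 < T) (hlam : 0 < lam) (hδ : δ ∈ Set.Ioc (0:ℝ) 2) :
    ∃ C > (0:ℝ), ∀ t ∈ Set.Icc T⁻¹ T, ∀ ε ∈ Set.Ioc (0:ℝ) 1,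
      (∫ y : ℝ, |heatKernel (t + ε) y - heatKernel t y|
          * Real.exp (lam * (1 + |y| ^ (2 - δ))))
        ≤ C * ε := by
  have hT0 : 0 < T := by linarith
  obtain ⟨a, ha, haT⟩ : ∃ a : ℝ, 0 < a ∧ a = T⁻¹ := ⟨_, inv_pos.2 hT0, rfl⟩
  obtain ⟨c, hc, hcT⟩ : ∃ c : ℝ, 0 < c ∧ c = 1 / (8 * (T + 1)) := ⟨_, by positivity, rfl⟩
  obtain ⟨M, hM⟩ := exists_mul_one_add_rpow_le hlam hδ hc
  set A : ℝ := (2 * Real.pi * a) ^ (-(1:ℝ)/2) with hA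
  have hApos : 0 < A := by positivity
  set K : ℝ := A * (1 / (2 * a ^ 2 * c) + 1 / (2 * a)) * Real.exp M with hK
  have hKpos : 0 < K := by positivity
  refine ⟨K * √(Real.pi / (2 * c)), by positivity, fun t ht ε hε => ?_⟩
  have hbound (y : ℝ) : |heatKernel (t + ε) y - heatKernel t y|
      * Real.exp (lam * (1 + |y| ^ (2 - δ))) ≤ K * ε * Real.exp (-(2 * c) * y ^ 2) := by
    have h1 := abs_heatKernel_sub_le ha (haT.trans_le ht.1) hε.1.le
      (add_le_add ht.2 hε.2) y
    have h2 : y ^ 2 / (2 * a ^ 2) + 1 / (2 * a) ≤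
        (1 / (2 * a ^ 2 * c) + 1 / (2 * a)) * Real.exp (c * y ^ 2) := by
      have e1 : c * y ^ 2 ≤ Real.exp (c * y ^ 2) := by
        linarith [Real.add_one_le_exp (c * y ^ 2)]
      have e2 : 1 ≤ Real.exp (c * y ^ 2) := Real.one_le_exp (by positivity)
      calc y ^ 2 / (2 * a ^ 2) + 1 / (2 * a)
          = 1 / (2 * a ^ 2 * c) * (c * y ^ 2) + 1 / (2 * a) * 1 := by field_simp
        _ ≤ 1 / (2 * a ^ 2 * c) * Real.exp (c * y ^ 2) + 1 / (2 * a) * Real.exp (c * y ^ 2) := by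
            gcongr
        _ = _ := by ring
    have h3 : -y ^ 2 / (2 * (T + 1)) = -(4 * c) * y ^ 2 := by
      rw [hcT]; field_simp; ring
    rw [h3] at h1
    have hε0 := hε.1.le
    calc _ ≤ A * Real.exp (-(4 * c) * y ^ 2) *
          ((1 / (2 * a ^ 2 * c) + 1 / (2 * a)) * Real.exp (c * y ^ 2)) * ε *
            Real.exp (M + c * y ^ 2) := by
          refine mul_le_mul (h1.trans ?_) (Real.exp_le_exp.2 (hM y)) (Real.exp_nonneg _)
            (by positivity)
          gcongr
      _ = K * ε * (Real.exp (-(4 * c) * y ^ 2) * Real.exp (c * y ^ 2) * Real.exp (c * y ^ 2)) := by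
          rw [Real.exp_add, hK]; ring
      _ = _ := by
          rw [← Real.exp_add, ← Real.exp_add]
          ring_nf
  calc _ ≤ ∫ y : ℝ, K * ε * Real.exp (-(2 * c) * y ^ 2) :=
        integral_mono_of_nonneg (.of_forall fun y => by positivity)
          ((integrable_exp_neg_mul_sq (by positivity)).const_mul _) (.of_forall hbound)
    _ = K * √(Real.pi / (2 * c)) * ε := by
        rw [integral_const_mul, integral_gaussian]; ring
end
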